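/- Let 1≤t≤h−1, let N≥0 and let i,j≥0 be integers with i+j≤N. Suppose given f'_M∈V_{t,M} for i≤M≤N−j with ⟨f'_M,f'_M⟩_{V_{t,M}} = Γ'·((A_t q^{t+2i};q)_{M−i}/(q;q)_{M−i})·q^{((M−2i)²+M+2i−2i²)/2}, and f''_{N−M}∈V_{h−t,N−M} for i≤M≤N−j with ⟨f''_{N−M},f''_{N−M}⟩_{V_{h−t,N−M}} = Γ''·((A_h A_t^{−1} q^{h−t+2j};q)_{N−M−j}/(q;q)_{N−M−j})·q^{((N−M−2j)²+N−M+2j−2j²)/2}, where Γ' and Γ'' are real constants independent of M (all exponents shown are integers). Let n,m be integers with i+j≤n≤N and i+j≤m≤N, set ψ_s(M,N−M)=Q_s(M−i; A_t q^{t+2i−1}, A_h A_t^{−1} q^{h−t+2j−1}, N−i−j | q) for s=n−i−j and s=m−i−j, and define f,g∈V_{h,N} by f(x)=q^{−jX_t}·ψ_{n−i−j}(X_t,N−X_t)·f'_{X_t}(x')·f''_{N−X_t}(x'') and g(x)=q^{−jX_t}·ψ_{m−i−j}(X_t,N−X_t)·f'_{X_t}(x')·f''_{N−X_t}(x'') for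 i≤X_t≤N−j, and f(x)=g(x)=0 otherwise. Then ⟨f,g⟩_{V_{h,N}} = δ_{n,m}·Γ·((A_h q^{h+2n};q)_{N−n}/(q;q)_{N−n})·q^{((N−2n)²+N+2n−2n²)/2}, where Γ = Γ'·Γ''·((q;q)_{n−i−j}(A_h q^{h+n+i+j−1};q)_{n−i−j}(A_h A_t^{−1} q^{h−t+2j};q)_{n−i−j}/(A_t q^{t+2i};q)_{n−i−j})·(A_t q^{t+2i})^{n−i}·q^{−2ij−(n−i−j)}. -/

import Mathlib

open Finset

noncomputable section

/-- q-shifted factorial `(a;q)_m`. -/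
def qPoch (q a : ℝ) (m : ℕ) : ℝ := ∏ k ∈ Finset.range m, (1 - a * q ^ k)

/-- Partial sum `X_k = x_1 + ⋯ + x_k` (entries of index `< k`, 0-indexed). -/
def Xlt {h : ℕ} (x : Fin h → ℕ) (k : ℕ) : ℕ := ∑ j : Fin h, if (j : ℕ) < k then x j else 0

/-- Partial product `A_k = α_1 ⋯ α_k` (entries of index `< k`, 0-indexed). -/
def Apar {h : ℕ} (α : Fin h → ℝ) (k : ℕ) : ℝ := ∏ j : Fin h, if (j : ℕ) < k then α j else 1

/-- Raising operator `R_N : V_{h,N} → V_{h,N+1}`. -/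
def Rop (q : ℝ) {h : ℕ} (N : ℕ) (f : (Fin h → ℕ) → ℂ) : (Fin h → ℕ) → ℂ := fun x =>
  ∑ i : Fin h, (q : ℂ) ^ ((Xlt x i : ℤ) - N - 1) * (1 - (q : ℂ) ^ (x i)) *
    f (Function.update x i (x i - 1))

/-- Lowering operator `L_N : V_{h,N} → V_{h,N-1}` (its defining formula does not involve `N`). -/
def Lop (q : ℝ) {h : ℕ} (α : Fin h → ℝ) (f : (Fin h → ℕ) → ℂ) : (Fin h → ℕ) → ℂ := fun x =>
  ∑ j : Fin h, ((Apar α j : ℝ) : ℂ) * (q : ℂ) ^ ((j : ℕ) + Xlt x j) *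
    ((α j : ℂ) * (q : ℂ) ^ (x j + 1) - 1) * f (Function.update x j (x j + 1))

/-- The multidimensional q-Hahn operator `D_N : V_{h,N} → V_{h,N}`. -/
def Dop (q : ℝ) {h : ℕ} (α : Fin h → ℝ) (N : ℕ) (f : (Fin h → ℕ) → ℂ) : (Fin h → ℕ) → ℂ :=
  fun x =>
    (∑ i : Fin h, ∑ j : Fin h,
      if i ≠ j then
        ((Apar α j : ℝ) : ℂ) *
          (q : ℂ) ^ ((((j : ℕ) + Xlt x j + Xlt x i : ℕ) : ℤ) - N -
            (if (i : ℕ) < (j : ℕ) then 1 else 0)) *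
          ((α j : ℂ) * (q : ℂ) ^ (x j + 1) - 1) * (1 - (q : ℂ) ^ (x i)) *
          f (Function.update (Function.update x j (x j + 1)) i (x i - 1))
      else 0)
    + ((∑ j : Fin h,
          ((Apar α j : ℝ) : ℂ) * (q : ℂ) ^ ((((j : ℕ) + 2 * Xlt x j : ℕ) : ℤ) - N) *
            ((α j : ℂ) * (q : ℂ) ^ (x j) - 1) * (1 - (q : ℂ) ^ (x j)))
        + (((Apar α h : ℝ) : ℂ) * (q : ℂ) ^ (((h + N : ℕ) : ℤ) - 1) - 1) *
            (1 - (q : ℂ) ^ (-(N : ℤ)))) * f x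

/-- Scalar product on `V_{h,N}`. -/
def innerV (q : ℝ) {h : ℕ} (α : Fin h → ℝ) (N : ℕ) (f g : (Fin h → ℕ) → ℂ) : ℂ :=
  (q : ℂ) ^ (N * (N + 1) / 2) *
    ∑ x ∈ Finset.Nat.antidiagonalTuple h N,
      (∏ i : Fin h, ((qPoch q (q * α i) (x i) / qPoch q q (x i) : ℝ) : ℂ) *
        ((α i * q : ℝ) : ℂ) ^ ((N : ℤ) - Xlt x ((i : ℕ) + 1))) *
      f x * (starRingEnd ℂ) (g x)

/-- `RopIter q n k f = R_{n+k-1} ⋯ R_{n+1} R_n f`. -/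
def RopIter (q : ℝ) {h : ℕ} (n : ℕ) : ℕ → ((Fin h → ℕ) → ℂ) → ((Fin h → ℕ) → ℂ)
  | 0, f => f
  | k + 1, f => Rop q (n + k) (RopIter q n k f)




/-- Two-variable raising operator `R_M : V_{2,M} → V_{2,M+1}` (on functions of `x = x₁`). -/
def R2 (q : ℝ) (M : ℕ) (g : ℕ → ℂ) : ℕ → ℂ := fun x =>
  (q : ℂ) ^ (-(M : ℤ) - 1) * (1 - (q : ℂ) ^ x) * g (x - 1) +
    (q : ℂ) ^ ((x : ℤ) - M - 1) * (1 - (q : ℂ) ^ ((M : ℤ) + 1 - x)) * g x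

/-- `R2Iter q n k g = R_{n+k-1} ⋯ R_{n+1} R_n g`. -/
def R2Iter (q : ℝ) (n : ℕ) : ℕ → (ℕ → ℂ) → (ℕ → ℂ)
  | 0, g => g
  | k + 1, g => R2 q (n + k) (R2Iter q n k g)

/-- The function `φ_n(x) = q^{-n²/2}(q;q)_n (abq^{n+1})^x (b⁻¹q^{-n};q)_x / (aq;q)_x`. -/
def phiH (q a b : ℝ) (n : ℕ) : ℕ → ℂ := fun x =>
  ((q ^ (-((n : ℝ) ^ 2) / 2) * qPoch q q n * (a * b * q ^ (n + 1)) ^ x *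
      qPoch q (b⁻¹ * q ^ (-(n : ℤ))) x / qPoch q (a * q) x : ℝ) : ℂ)

/-- The one-dimensional q-Hahn polynomial `Q_n(x; a, b, N | q)`. -/
def qHahnQ (q a b : ℝ) (n N : ℕ) : ℕ → ℂ := fun x =>
  ((q : ℂ) ^ ((N - n) * (N - n + 1) / 2) / ((qPoch q q (N - n) : ℝ) : ℂ)) *
    R2Iter q n (N - n) (phiH q a b n) x

/-- The left block `x' = (x_1, …, x_t)` of a tuple `x` (used only when `t ≤ h`). -/
def xL (h t : ℕ) (x : Fin h → ℕ) : Fin t → ℕ := fun i =>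
  if hi : (i : ℕ) < h then x ⟨i, hi⟩ else 0

/-- The right block `x'' = (x_{t+1}, …, x_h)` of a tuple `x`. -/
def xR (h t : ℕ) (x : Fin h → ℕ) : Fin (h - t) → ℕ := fun i =>
  if hi : t + (i : ℕ) < h then x ⟨t + i, hi⟩ else 0

/-- The left block `(α_1, …, α_t)` of the parameters (used only when `t ≤ h`). -/
def alphaL (h t : ℕ) (α : Fin h → ℝ) : Fin t → ℝ := fun i =>
  if hi : (i : ℕ) < h then α ⟨i, hi⟩ else 1

/-- The right block `(α_{t+1}, …, α_h)` of the parameters. -/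
def alphaR (h t : ℕ) (α : Fin h → ℝ) : Fin (h - t) → ℝ := fun i =>
  if hi : t + (i : ℕ) < h then α ⟨t + i, hi⟩ else 1


lemma qPoch_zero (q a : ℝ) : qPoch q a 0 = 1 := by simp [qPoch]

lemma qPoch_succ (q a : ℝ) (m : ℕ) : qPoch q a (m + 1) = qPoch q a m * (1 - a * q ^ m) := by
  simp [qPoch, Finset.prod_range_succ]

lemma qPoch_succ' (q a : ℝ) (m : ℕ) : qPoch q a (m + 1) = (1 - a) * qPoch q (a * q) m := by
  simp only [qPoch, Finset.prod_range_succ', pow_zero, mul_one]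
  rw [mul_comm]
  congr 1
  refine Finset.prod_congr rfl fun k _ => ?_
  ring

lemma qPoch_add (q a : ℝ) (m k : ℕ) :
    qPoch q a (m + k) = qPoch q a m * qPoch q (a * q ^ m) k := by
  simp only [qPoch, Finset.prod_range_add]
  congr 1
  refine Finset.prod_congr rfl fun k _ => ?_
  ring

lemma qPoch_pos {q a : ℝ} (hq0 : 0 < q) (hq1 : q < 1) (ha1 : a < 1) (m : ℕ) :
    0 < qPoch q a m := by
  refine Finset.prod_pos fun k _ => ?_
  have h1 : q ^ k ≤ 1 := pow_le_one₀ hq0.le hq1.le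
  have h2 : 0 < q ^ k := pow_pos hq0 k
  nlinarith

/-- The `q`-Chu–Vandermonde sum. -/
lemma qChuVandermonde {q : ℝ} (hq0 : 0 < q) (hq1 : q < 1) (β : ℝ) (n : ℕ) : ∀ d : ℝ,
    ∑ x ∈ Finset.range (n + 1), qPoch q q n / (qPoch q q x * qPoch q q (n - x)) *
      (-1) ^ x * q ^ (x.choose 2) * d ^ x * qPoch q β x * qPoch q (d * β * q ^ x) (n - x)
      = qPoch q d n := by
  induction n with
  | zero => intro d; simp [qPoch_zero]
  | succ n ih =>
    intro d
    have hp : ∀ m, qPoch q q m ≠ 0 := fun m => (qPoch_pos hq0 hq1 hq1 m).ne'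
    have hfac : ∀ m : ℕ, (1 - q * q ^ m) ≠ 0 := fun m h => by
      have := hp (m + 1)
      rw [qPoch_succ, h, mul_zero] at this
      exact this rfl
    rw [qPoch_succ' q d n, ← ih (d * q), Finset.mul_sum]
    have split : ∀ x ∈ Finset.range (n + 1 + 1),
        qPoch q q (n + 1) / (qPoch q q x * qPoch q q (n + 1 - x)) *
          (-1) ^ x * q ^ (x.choose 2) * d ^ x * qPoch q β x *
            qPoch q (d * β * q ^ x) (n + 1 - x)
        = qPoch q q n * (q ^ x * (1 - q ^ (n + 1 - x))) / (qPoch q q x * qPoch q q (n + 1 - x)) *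
          (-1) ^ x * q ^ (x.choose 2) * d ^ x * qPoch q β x *
            qPoch q (d * β * q ^ x) (n + 1 - x)
        + qPoch q q n * (1 - q ^ x) / (qPoch q q x * qPoch q q (n + 1 - x)) *
          (-1) ^ x * q ^ (x.choose 2) * d ^ x * qPoch q β x *
            qPoch q (d * β * q ^ x) (n + 1 - x) := by
      intro x hx
      have hx' : x ≤ n + 1 := by simpa [Nat.lt_succ_iff] using hx
      have h1 : q ^ x * q ^ (n + 1 - x) = q * q ^ n := by
        rw [← pow_add, Nat.add_sub_cancel' hx', pow_succ, mul_comm]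
      have h2 : q ^ x * (1 - q ^ (n + 1 - x)) = q ^ x - q * q ^ n := by rw [← h1]; ring
      rw [h2, qPoch_succ q q n]
      ring
    rw [Finset.sum_congr rfl split, Finset.sum_add_distrib, Finset.sum_range_succ,
      Finset.sum_range_succ' (fun x => qPoch q q n * (1 - q ^ x) /
        (qPoch q q x * qPoch q q (n + 1 - x)) * (-1) ^ x * q ^ (x.choose 2) * d ^ x *
        qPoch q β x * qPoch q (d * β * q ^ x) (n + 1 - x))]
    simp only [Nat.sub_self, pow_zero, sub_self, mul_zero, zero_div, zero_mul, add_zero]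
    rw [← Finset.sum_add_distrib]
    refine Finset.sum_congr rfl fun x hx => ?_
    obtain ⟨y, rfl⟩ : ∃ y, n = x + y :=
      ⟨n - x, by have := Finset.mem_range.1 hx; omega⟩
    have e1 : x + y + 1 - x = y + 1 := by omega
    have e2 : x + y - x = y := by omega
    have e3 : x + y + 1 - (x + 1) = y := by omega
    have e4 : (x + 1).choose 2 = x.choose 2 + x := by
      rw [Nat.choose_succ_succ' x 1, Nat.choose_one_right, add_comm]
    rw [e1, e2, e3, e4, qPoch_succ' q (d * β * q ^ x) y, qPoch_succ q q x, qPoch_succ q q y,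
      qPoch_succ q β x]
    have e5 : d * β * q ^ x * q = d * q * β * q ^ x := by ring
    have e6 : d * β * q ^ (x + 1) = d * q * β * q ^ x := by ring
    rw [e5, e6]
    have := hp x
    have := hp y
    have := hfac x
    have := hfac y
    have e7 : 1 - q ^ (y + 1) = 1 - q * q ^ y := by ring
    have e8 : 1 - q ^ (x + 1) = 1 - q * q ^ x := by ring
    rw [e7, e8, mul_pow, pow_add q]
    generalize q ^ x = X at *
    generalize q ^ y = Y at *
    generalize hF : 1 - q * X = F at *
    field_simp
    ring

/-- Weight of the one-dimensional `q`-Hahn polynomials. -/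
def qHahnWeight (q a b : ℝ) (M x : ℕ) : ℝ :=
  qPoch q (a * q) x * qPoch q (b * q) (M - x) / (qPoch q q x * qPoch q q (M - x)) *
    (a * q) ^ (M - x)

/-- Bilinear form attached to `qHahnWeight`. -/
def qHahnForm (q a b : ℝ) (M : ℕ) (f g : ℕ → ℝ) : ℝ :=
  ∑ x ∈ Finset.range (M + 1), qHahnWeight q a b M x * (f x * g x)

/-- Real raising operator into degree `M`, without the factor `q ^ (-M)`. -/
def raiseR (q : ℝ) (M : ℕ) (g : ℕ → ℝ) : ℕ → ℝ := fun x =>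
  (1 - q ^ x) * g (x - 1) + (q ^ x - q ^ M) * g x

/-- Adjoint of `raiseR`. -/
def lowerR (q a b : ℝ) (M : ℕ) (g : ℕ → ℝ) : ℕ → ℝ := fun x =>
  (1 - a * q ^ (x + 1)) * g (x + 1) + a * q * (q ^ x - b * q ^ M) * g x

/-- Iterated raising operator, from degree `n` to degree `n + k`. -/
def raiseIter (q : ℝ) (n : ℕ) : ℕ → (ℕ → ℝ) → ℕ → ℝ
  | 0, g => g
  | k + 1, g => raiseR q (n + k + 1) (raiseIter q n k g)

lemma qHahnForm_comm (q a b : ℝ) (M : ℕ) (f g : ℕ → ℝ) :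
    qHahnForm q a b M f g = qHahnForm q a b M g f :=
  Finset.sum_congr rfl fun x _ => by ring

lemma qHahnForm_smul_right (q a b c : ℝ) (M : ℕ) (f g : ℕ → ℝ) :
    qHahnForm q a b M f (c • g) = c * qHahnForm q a b M f g := by
  simp only [qHahnForm, Finset.mul_sum, Pi.smul_apply, smul_eq_mul]
  exact Finset.sum_congr rfl fun x _ => by ring

lemma qHahnForm_raise {q : ℝ} (hq0 : 0 < q) (hq1 : q < 1) (a b : ℝ) (M : ℕ) (f g : ℕ → ℝ) :
    qHahnForm q a b (M + 1) (raiseR q (M + 1) f) g =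
      qHahnForm q a b M f (lowerR q a b (M + 1) g) := by
  have hp : ∀ m, qPoch q q m ≠ 0 := fun m => (qPoch_pos hq0 hq1 hq1 m).ne'
  have hfac : ∀ m : ℕ, (1 - q * q ^ m) ≠ 0 := fun m h => by
    have := hp (m + 1)
    rw [qPoch_succ, h, mul_zero] at this
    exact this rfl
  unfold qHahnForm
  have split : ∀ x ∈ Finset.range (M + 1 + 1),
      qHahnWeight q a b (M + 1) x * (raiseR q (M + 1) f x * g x) =
      qHahnWeight q a b (M + 1) x * ((1 - q ^ x) * f (x - 1) * g x) +
      qHahnWeight q a b (M + 1) x * ((q ^ x - q ^ (M + 1)) * f x * g x) := fun x _ => by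
    simp only [raiseR]; ring
  rw [Finset.sum_congr rfl split, Finset.sum_add_distrib, Finset.sum_range_succ',
    Finset.sum_range_succ (fun x =>
      qHahnWeight q a b (M + 1) x * ((q ^ x - q ^ (M + 1)) * f x * g x))]
  simp only [pow_zero, sub_self, zero_mul, mul_zero, add_zero]
  rw [← Finset.sum_add_distrib]
  refine Finset.sum_congr rfl fun x hx => ?_
  obtain ⟨y, rfl⟩ : ∃ y, M = x + y :=
    ⟨M - x, by have := Finset.mem_range.1 hx; omega⟩
  have e1 : x + y + 1 - x = y + 1 := by omega
  have e2 : x + y - x = y := by omega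
  have e3 : x + y + 1 - (x + 1) = y := by omega
  simp only [qHahnWeight, lowerR, e1, e2, e3, qPoch_succ, Nat.add_sub_cancel]
  have := hp x
  have := hp y
  have := hfac x
  have := hfac y
  have e7 : q ^ x - q ^ (x + y + 1) = q ^ x * (1 - q * q ^ y) := by ring
  have e8 : 1 - q ^ (x + 1) = 1 - q * q ^ x := by ring
  rw [e7, e8]
  field_simp
  ring

lemma lowerR_raiseR (q a b : ℝ) (M : ℕ) (g : ℕ → ℝ) :
    lowerR q a b (M + 1) (raiseR q (M + 1) g) =
      q • raiseR q M (lowerR q a b M g) + ((1 - q) * (1 - a * b * q ^ (2 * M + 2))) • g := by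
  funext x
  cases x with
  | zero => simp [lowerR, raiseR]; ring
  | succ x => simp [lowerR, raiseR]; ring

lemma raiseR_smul (q c : ℝ) (M : ℕ) (g : ℕ → ℝ) : raiseR q M (c • g) = c • raiseR q M g := by
  funext x; simp [raiseR]; ring

lemma lowerR_raiseIter (q a b : ℝ) (n : ℕ) (φ : ℕ → ℝ) (hφ : lowerR q a b n φ = 0) (k : ℕ) :
    lowerR q a b (n + k + 1) (raiseIter q n (k + 1) φ) =
      ((1 - q ^ (k + 1)) * (1 - a * b * q ^ (2 * n + k + 2))) • raiseIter q n k φ := by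
  induction k with
  | zero =>
    simp only [raiseIter, add_zero]
    rw [lowerR_raiseR, hφ]
    funext x
    simp [raiseR]
  | succ k ih =>
    rw [raiseIter, lowerR_raiseR, ← add_assoc, ih, raiseR_smul, ← raiseIter]
    funext x
    simp only [Pi.add_apply, Pi.smul_apply, smul_eq_mul]
    ring

lemma qHahnForm_raiseIter_eq_zero {q : ℝ} (hq0 : 0 < q) (hq1 : q < 1) (a b : ℝ) (n : ℕ)
    (φ : ℕ → ℝ) (m : ℕ) (χ : ℕ → ℝ) (hχ : lowerR q a b m χ = 0) (l : ℕ) :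
    ∀ k, l < k → n + k = m + l →
      qHahnForm q a b (n + k) (raiseIter q n k φ) (raiseIter q m l χ) = 0 := by
  induction l with
  | zero =>
    intro k hk hkl
    obtain ⟨k, rfl⟩ := Nat.exists_eq_succ_of_ne_zero hk.ne'
    have hm : m = n + k + 1 := by omega
    have h0 : raiseIter q m 0 χ = χ := rfl
    rw [Nat.succ_eq_add_one, h0, raiseIter, ← add_assoc, qHahnForm_raise hq0 hq1, ← hm, hχ]
    simp [qHahnForm]
  | succ l ih =>
    intro k hk hkl
    obtain ⟨k, rfl⟩ := Nat.exists_eq_succ_of_ne_zero (by omega : k ≠ 0)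
    have hm : n + k + 1 = m + l + 1 := by omega
    rw [Nat.succ_eq_add_one, raiseIter, ← add_assoc, qHahnForm_raise hq0 hq1, hm,
      lowerR_raiseIter q a b m χ hχ, qHahnForm_smul_right, ih k (by omega) (by omega), mul_zero]

lemma qHahnForm_raiseIter_self {q : ℝ} (hq0 : 0 < q) (hq1 : q < 1) (a b : ℝ) (n : ℕ)
    (φ : ℕ → ℝ) (hφ : lowerR q a b n φ = 0) (k : ℕ) :
    qHahnForm q a b (n + k) (raiseIter q n k φ) (raiseIter q n k φ) =
      qPoch q q k * qPoch q (a * b * q ^ (2 * n + 2)) k * qHahnForm q a b n φ φ := by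
  induction k with
  | zero => simp [raiseIter, qPoch_zero]
  | succ k ih =>
    rw [← add_assoc]
    nth_rewrite 1 [raiseIter]
    rw [qHahnForm_raise hq0 hq1, lowerR_raiseIter q a b n φ hφ, qHahnForm_smul_right, ih,
      qPoch_succ, qPoch_succ]
    ring

/-- Real form of `phiH`. -/
def phiR (q a b : ℝ) (n : ℕ) : ℕ → ℝ := fun x =>
  q ^ (-((n : ℝ) ^ 2) / 2) * qPoch q q n * (a * b * q ^ (n + 1)) ^ x *
      qPoch q (b⁻¹ * q ^ (-(n : ℤ))) x / qPoch q (a * q) x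

lemma lowerR_phiR {q : ℝ} (hq0 : 0 < q) (hq1 : q < 1) {a b : ℝ} (ha1 : a * q < 1)
    (hb : b ≠ 0) (n : ℕ) : lowerR q a b n (phiR q a b n) = 0 := by
  funext x
  have h0 := (qPoch_pos hq0 hq1 ha1 x).ne'
  have h1 := (qPoch_pos hq0 hq1 ha1 (x + 1)).ne'
  rw [qPoch_succ] at h1
  have h2 := right_ne_zero_of_mul h1
  have h3 : 1 - a * q ^ (x + 1) = 1 - a * q * q ^ x := by ring
  have hq := hq0.ne'
  simp only [lowerR, phiR, Pi.zero_apply, qPoch_succ, h3, zpow_neg, zpow_natCast]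
  field_simp
  ring

/-- Reversal of the order of the factors in a `q`-shifted factorial. -/
lemma qPoch_mul_reverse {q b : ℝ} (hq : q ≠ 0) (hb : b ≠ 0) (y x : ℕ) :
    qPoch q (b * q) y * qPoch q (b⁻¹ * q ^ (-((x + y : ℕ) : ℤ))) x * (b * q ^ (x + y)) ^ x =
      qPoch q (b * q) (x + y) * (-1) ^ x * q ^ (x.choose 2) := by
  induction x generalizing y with
  | zero => simp [qPoch_zero]
  | succ x ih =>
    have h := ih (y + 1)
    have e1 : x + (y + 1) = x + 1 + y := by omega
    have e4 : (x + 1).choose 2 = x.choose 2 + x := by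
      rw [Nat.choose_succ_succ' x 1, Nat.choose_one_right, add_comm]
    rw [e1, qPoch_succ] at h
    rw [qPoch_succ, e4, pow_succ (b * q ^ (x + 1 + y)), pow_succ (-1 : ℝ), pow_add q]
    have e2 : (1 - b⁻¹ * q ^ (-((x + 1 + y : ℕ) : ℤ)) * q ^ x) * (b * q ^ (x + 1 + y)) =
        - (q ^ x * (1 - b * q * q ^ y)) := by
      rw [zpow_neg, zpow_natCast]
      field_simp
      ring
    linear_combination (- q ^ x) * h + (qPoch q (b * q) y *
      qPoch q (b⁻¹ * q ^ (-((x + 1 + y : ℕ) : ℤ))) x * (b * q ^ (x + 1 + y)) ^ x) * e2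

lemma qHahnForm_phiR {q : ℝ} (hq0 : 0 < q) (hq1 : q < 1) {a b : ℝ} (ha : a ≠ 0)
    (ha1 : a * q < 1) (hb : b ≠ 0) (n : ℕ) :
    q ^ (n ^ 2) * qHahnForm q a b n (phiR q a b n) (phiR q a b n) =
      qPoch q q n * qPoch q (b * q) n * (a * q) ^ n * qPoch q (a * b * q ^ (n + 1)) n /
        qPoch q (a * q) n := by
  have hp : ∀ m, qPoch q q m ≠ 0 := fun m => (qPoch_pos hq0 hq1 hq1 m).ne'
  have hpa : ∀ m, qPoch q (a * q) m ≠ 0 := fun m => (qPoch_pos hq0 hq1 ha1 m).ne'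
  have hq := hq0.ne'
  have hrp : q ^ (n ^ 2) * (q ^ (-((n : ℝ) ^ 2) / 2)) ^ 2 = 1 := by
    rw [← Real.rpow_natCast q (n ^ 2), ← Real.rpow_mul_natCast hq0.le, ← Real.rpow_add hq0]
    push_cast
    rw [show (n : ℝ) ^ 2 + -(n : ℝ) ^ 2 / 2 * 2 = 0 by ring, Real.rpow_zero]
  rw [← qChuVandermonde hq0 hq1 (b⁻¹ * q ^ (-(n : ℤ))) n (a * b * q ^ (n + 1)), qHahnForm, Finset.mul_sum,
    Finset.mul_sum, Finset.sum_div]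
  refine Finset.sum_congr rfl fun x hx => ?_
  obtain ⟨y, rfl⟩ : ∃ y, n = x + y :=
    ⟨n - x, by have := Finset.mem_range.1 hx; omega⟩
  have e2 : x + y - x = y := by omega
  have e5 : a * b * q ^ (x + y + 1) * (b⁻¹ * q ^ (-((x + y : ℕ) : ℤ))) = a * q := by
    rw [zpow_neg, zpow_natCast]
    field_simp
    ring
  have key := qPoch_mul_reverse hq hb y x
  have key2 := qPoch_add q (a * q) x y
  simp only [qHahnWeight, phiR, e2, e5]
  generalize qPoch q (b⁻¹ * q ^ (-((x + y : ℕ) : ℤ))) x = β at *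
  generalize q ^ (-(((x + y : ℕ) : ℝ) ^ 2) / 2) = R at *
  generalize hD : a * b * q ^ (x + y + 1) = D
  have hD' : D ^ x = (a * q) ^ x * (b * q ^ (x + y)) ^ x := by
    rw [← hD, ← mul_pow]; ring
  have hG : qPoch q (a * q * q ^ x) y ≠ 0 := right_ne_zero_of_mul (key2 ▸ hpa (x + y))
  have hPx := hpa x
  have hqx := hp x
  have hqy := hp y
  rw [key2, pow_add (a * q)]
  generalize qPoch q (a * q) x = P at hPx ⊢
  generalize qPoch q (a * q * q ^ x) y = G at hG ⊢
  calc _ = (q ^ ((x + y) ^ 2) * R ^ 2) * (qPoch q (b * q) y * β * (b * q ^ (x + y)) ^ x) *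
        ((a * q) ^ x * (a * q) ^ y * qPoch q q (x + y) ^ 2 * D ^ x * β /
          (P * qPoch q q x * qPoch q q y)) := by
        rw [hD']
        field_simp
    _ = _ := by
        rw [hrp, key]
        field_simp

/-- Real form of `qHahnQ`. -/
def qHahnR (q a b : ℝ) (n K : ℕ) : ℕ → ℝ :=
  ((q ^ (n * (K - n)))⁻¹ / qPoch q q (K - n)) • raiseIter q n (K - n) (phiR q a b n)

lemma R2Iter_phiH {q : ℝ} (hq : q ≠ 0) (a b : ℝ) (n k : ℕ) (x : ℕ) :
    R2Iter q n k (phiH q a b n) x =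
      (((q ^ (n * k + k * (k + 1) / 2))⁻¹ * raiseIter q n k (phiR q a b n) x : ℝ) : ℂ) := by
  induction k generalizing x with
  | zero => simp [R2Iter, raiseIter, phiH, phiR]
  | succ k ih =>
    have hqc : (q : ℂ) ≠ 0 := by exact_mod_cast hq
    have e1 : n * (k + 1) + (k + 1) * (k + 1 + 1) / 2 = (n * k + k * (k + 1) / 2) + (n + k + 1) := by
      have : (k + 1) * (k + 1 + 1) = k * (k + 1) + 2 * (k + 1) := by ring
      rw [this, Nat.add_mul_div_left _ _ two_pos]
      ring
    have e2 : (q : ℂ) ^ ((x : ℤ) - ((n + k : ℕ) : ℤ) - 1) * (1 - (q : ℂ) ^ (((n + k : ℕ) : ℤ) + 1 - x))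
        = ((q : ℂ) ^ (n + k + 1))⁻¹ * ((q : ℂ) ^ x - (q : ℂ) ^ (n + k + 1)) := by
      rw [mul_sub, ← zpow_add₀ hqc]
      have h1 : (x : ℤ) - ((n + k : ℕ) : ℤ) - 1 = (x : ℤ) - ((n + k + 1 : ℕ) : ℤ) := by
        push_cast; ring
      have h2 : (x : ℤ) - ((n + k : ℕ) : ℤ) - 1 + (((n + k : ℕ) : ℤ) + 1 - x) = 0 := by ring
      rw [h2, h1, zpow_sub₀ hqc, zpow_natCast, zpow_natCast, zpow_zero]
      have := pow_ne_zero (n + k + 1) hqc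
      field_simp
    have e3 : (q : ℂ) ^ (-((n + k : ℕ) : ℤ) - 1) = ((q : ℂ) ^ (n + k + 1))⁻¹ := by
      rw [← zpow_natCast, ← zpow_neg]
      congr 1
      push_cast; ring
    rw [R2Iter, R2, raiseIter, raiseR, ih, ih, e2, e3, e1, pow_add q (n * k + k * (k + 1) / 2)]
    push_cast
    rw [mul_inv]
    ring

lemma qHahnQ_eq {q : ℝ} (hq : q ≠ 0) (a b : ℝ) (n K : ℕ) (x : ℕ) :
    qHahnQ q a b n K x = ((qHahnR q a b n K x : ℝ) : ℂ) := by
  rw [qHahnQ, R2Iter_phiH hq, qHahnR]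
  have hqc : (q : ℂ) ≠ 0 := by exact_mod_cast hq
  have := pow_ne_zero ((K - n) * (K - n + 1) / 2) hqc
  simp only [Pi.smul_apply, smul_eq_mul]
  push_cast
  rw [pow_add]
  field_simp

lemma qHahnForm_smul_left (q a b c : ℝ) (M : ℕ) (f g : ℕ → ℝ) :
    qHahnForm q a b M (c • f) g = c * qHahnForm q a b M f g := by
  rw [qHahnForm_comm, qHahnForm_smul_right, qHahnForm_comm]

lemma qHahnForm_qHahnR_of_ne {q : ℝ} (hq0 : 0 < q) (hq1 : q < 1) {a b : ℝ}
    (ha1 : a * q < 1) (hb : b ≠ 0) {n m K : ℕ} (hn : n ≤ K) (hm : m ≤ K) (hnm : n ≠ m) :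
    qHahnForm q a b K (qHahnR q a b n K) (qHahnR q a b m K) = 0 := by
  wlog hlt : n < m generalizing n m
  · rw [qHahnForm_comm]
    exact this hm hn hnm.symm (by omega)
  rw [qHahnR, qHahnR, qHahnForm_smul_left, qHahnForm_smul_right]
  have h := qHahnForm_raiseIter_eq_zero hq0 hq1 a b n (phiR q a b n) m (phiR q a b m)
    (lowerR_phiR hq0 hq1 ha1 hb m) (K - m) (K - n) (by omega) (by omega)
  rw [Nat.add_sub_cancel' hn] at h
  rw [h, mul_zero, mul_zero]

lemma qHahnForm_qHahnR_self {q : ℝ} (hq0 : 0 < q) (hq1 : q < 1) {a b : ℝ} (ha : a ≠ 0)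
    (ha1 : a * q < 1) (hb : b ≠ 0) (n k : ℕ) :
    qHahnForm q a b (n + k) (qHahnR q a b n (n + k)) (qHahnR q a b n (n + k)) =
      (q ^ (n ^ 2 + 2 * n * k))⁻¹ *
        (qPoch q (a * b * q ^ (2 * n + 2)) k / qPoch q q k) *
        (qPoch q q n * qPoch q (b * q) n * (a * q) ^ n * qPoch q (a * b * q ^ (n + 1)) n /
        qPoch q (a * q) n) := by
  have hp := (qPoch_pos hq0 hq1 hq1 k).ne'
  have hq := hq0.ne'
  rw [qHahnR, qHahnForm_smul_left, qHahnForm_smul_right, Nat.add_sub_cancel_left,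
    qHahnForm_raiseIter_self hq0 hq1 a b n _ (lowerR_phiR hq0 hq1 ha1 hb n),
    ← qHahnForm_phiR hq0 hq1 ha ha1 hb n]
  have e : q ^ (n ^ 2 + 2 * n * k) = q ^ (n ^ 2) * (q ^ (n * k)) ^ 2 := by
    rw [← pow_mul, ← pow_add]; ring_nf
  rw [e]
  field_simp

lemma prod_fin_split {R : Type*} [CommMonoid R] {h t : ℕ} (s : ℕ) (hs : h = t + s)
    (G : Fin h → R) :
    ∏ i, G i = (∏ i : Fin t, G ⟨i, by omega⟩) * ∏ i : Fin s, G ⟨t + i, by omega⟩ := by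
  subst hs
  exact Fin.prod_univ_add G

lemma sum_fin_split {R : Type*} [AddCommMonoid R] {h t : ℕ} (s : ℕ) (hs : h = t + s)
    (G : Fin h → R) :
    ∑ i, G i = (∑ i : Fin t, G ⟨i, by omega⟩) + ∑ i : Fin s, G ⟨t + i, by omega⟩ := by
  subst hs
  exact Fin.sum_univ_add G

lemma xL_apply {h t : ℕ} (ht : t ≤ h) (x : Fin h → ℕ) (i : Fin t) :
    xL h t x i = x ⟨i, by omega⟩ := by
  simp [xL, show (i : ℕ) < h by omega]

lemma xR_apply {h t : ℕ} (x : Fin h → ℕ) (i : Fin (h - t)) :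
    xR h t x i = x ⟨t + i, by omega⟩ := by
  simp [xR, show t + (i : ℕ) < h by omega]

lemma alphaL_apply {h t : ℕ} (ht : t ≤ h) (x : Fin h → ℝ) (i : Fin t) :
    alphaL h t x i = x ⟨i, by omega⟩ := by
  simp [alphaL, show (i : ℕ) < h by omega]

lemma alphaR_apply {h t : ℕ} (x : Fin h → ℝ) (i : Fin (h - t)) :
    alphaR h t x i = x ⟨t + i, by omega⟩ := by
  simp [alphaR, show t + (i : ℕ) < h by omega]

lemma Xlt_of_le {h t : ℕ} (ht : t ≤ h) (x : Fin h → ℕ) {k : ℕ} (hk : k ≤ t) :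
    Xlt x k = Xlt (xL h t x) k := by
  rw [Xlt, sum_fin_split (h - t) (by omega : h = t + (h - t)), Xlt]
  have h0 : ∀ i : Fin (h - t), ¬ (t + (i : ℕ) < k) := fun i => by omega
  simp [h0, xL_apply ht]

lemma Xlt_eq_sum {h t : ℕ} (ht : t ≤ h) (x : Fin h → ℕ) : Xlt x t = ∑ i, xL h t x i := by
  rw [Xlt_of_le ht x le_rfl, Xlt]
  exact Finset.sum_congr rfl fun i _ => if_pos i.2

lemma Xlt_add {h t : ℕ} (ht : t ≤ h) (x : Fin h → ℕ) (k : ℕ) :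
    Xlt x (t + k) = Xlt x t + Xlt (xR h t x) k := by
  rw [Xlt_eq_sum ht, Xlt, sum_fin_split (h - t) (by omega : h = t + (h - t)), Xlt]
  have h0 : ∀ i : Fin t, (i : ℕ) < t + k := fun i => by omega
  simp [h0, xL_apply ht, xR_apply]

lemma sum_eq_add {h t : ℕ} (ht : t ≤ h) (x : Fin h → ℕ) :
    ∑ i, x i = ∑ i, xL h t x i + ∑ i, xR h t x i := by
  rw [sum_fin_split (h - t) (by omega : h = t + (h - t))]
  simp [xL_apply ht, xR_apply]

/-- Concatenation of two blocks. -/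
def glueBlocks (h t : ℕ) (u : Fin t → ℕ) (v : Fin (h - t) → ℕ) : Fin h → ℕ := fun i =>
  if hi : (i : ℕ) < t then u ⟨i, hi⟩ else v ⟨i - t, by omega⟩

lemma xL_glueBlocks {h t : ℕ} (ht : t ≤ h) (u : Fin t → ℕ) (v : Fin (h - t) → ℕ) :
    xL h t (glueBlocks h t u v) = u := by
  funext i
  simp [xL_apply ht, glueBlocks]

lemma xR_glueBlocks {h t : ℕ} (u : Fin t → ℕ) (v : Fin (h - t) → ℕ) :
    xR h t (glueBlocks h t u v) = v := by
  funext i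
  simp [xR_apply, glueBlocks]

lemma glueBlocks_xL_xR {h t : ℕ} (ht : t ≤ h) (x : Fin h → ℕ) :
    glueBlocks h t (xL h t x) (xR h t x) = x := by
  funext i
  by_cases hi : (i : ℕ) < t
  · simp [glueBlocks, hi, xL_apply ht]
  · simp [glueBlocks, hi, xR_apply, Nat.add_sub_cancel' (not_lt.1 hi)]

lemma sum_antidiagonalTuple_split {R : Type*} [AddCommMonoid R] {h t : ℕ} (ht : t ≤ h) (N : ℕ)
    (F : (Fin h → ℕ) → R) :
    ∑ x ∈ Finset.Nat.antidiagonalTuple h N, F x =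
      ∑ M ∈ Finset.range (N + 1), ∑ u ∈ Finset.Nat.antidiagonalTuple t M,
        ∑ v ∈ Finset.Nat.antidiagonalTuple (h - t) (N - M), F (glueBlocks h t u v) := by
  simp_rw [← Finset.sum_product']
  rw [Finset.sum_sigma']
  refine Finset.sum_nbij' (fun x => ⟨∑ i, xL h t x i, (xL h t x, xR h t x)⟩)
    (fun p => glueBlocks h t p.2.1 p.2.2) ?_ ?_ ?_ ?_ ?_
  · intro x hx
    rw [Finset.Nat.mem_antidiagonalTuple, sum_eq_add ht] at hx
    simp only [Finset.mem_sigma, Finset.mem_range, Finset.mem_product,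
      Finset.Nat.mem_antidiagonalTuple, true_and]
    omega
  · rintro ⟨M, u, v⟩ hp
    simp only [Finset.mem_sigma, Finset.mem_range, Finset.mem_product,
      Finset.Nat.mem_antidiagonalTuple] at hp
    rw [Finset.Nat.mem_antidiagonalTuple, sum_eq_add ht, xL_glueBlocks ht, xR_glueBlocks]
    dsimp only
    omega
  · intro x _
    exact glueBlocks_xL_xR ht x
  · rintro ⟨M, u, v⟩ hp
    simp only [Finset.mem_sigma, Finset.mem_range, Finset.mem_product,
      Finset.Nat.mem_antidiagonalTuple] at hp
    simp only [xL_glueBlocks ht, xR_glueBlocks, hp.2.1]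
  · intro x _
    rw [glueBlocks_xL_xR ht]

/-- Weight of the scalar product `innerV`. -/
def weightV (q : ℝ) {h : ℕ} (α : Fin h → ℝ) (N : ℕ) (x : Fin h → ℕ) : ℂ :=
  ∏ i : Fin h, ((qPoch q (q * α i) (x i) / qPoch q q (x i) : ℝ) : ℂ) *
    ((α i * q : ℝ) : ℂ) ^ ((N : ℤ) - Xlt x ((i : ℕ) + 1))

lemma Apar_mul_pow {h t : ℕ} (ht : t ≤ h) (q : ℝ) (α : Fin h → ℝ) :
    Apar α t * q ^ t = ∏ i : Fin t, alphaL h t α i * q := by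
  rw [Finset.prod_mul_distrib, Apar, prod_fin_split (h - t) (by omega : h = t + (h - t))]
  simp [alphaL_apply ht]

lemma Apar_div_mul_pow {h t : ℕ} (ht : t ≤ h) (q : ℝ) (α : Fin h → ℝ) (hα : ∀ s, 0 < α s) :
    Apar α h / Apar α t * q ^ (h - t) = ∏ i : Fin (h - t), alphaR h t α i * q := by
  have e1 : Apar α h = Apar α t * ∏ i : Fin (h - t), alphaR h t α i := by
    rw [Apar, Apar, prod_fin_split (h - t) (by omega : h = t + (h - t)),
      prod_fin_split (t := t) (h - t) (by omega) (fun j => if (j : ℕ) < t then α j else 1)]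
    have h0 : ∀ i : Fin (h - t), t + (i : ℕ) < h := fun i => by omega
    have h1 : ∀ i : Fin t, (i : ℕ) < h := fun i => by omega
    simp [alphaR_apply, h0, h1]
  have h2 : Apar α t ≠ 0 := by
    refine (Finset.prod_pos fun i _ => ?_).ne'
    split_ifs
    exacts [hα i, one_pos]
  rw [e1, mul_div_cancel_left₀ _ h2, Finset.prod_mul_distrib]
  simp

lemma weightV_glueBlocks {q : ℝ} (hq : q ≠ 0) {h t : ℕ} (ht : t ≤ h) (α : Fin h → ℝ)
    (hα : ∀ s, 0 < α s) {N M : ℕ} (hM : M ≤ N) (u : Fin t → ℕ) (hu : ∑ i, u i = M)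
    (v : Fin (h - t) → ℕ) :
    weightV q α N (glueBlocks h t u v) =
      weightV q (alphaL h t α) M u * ((Apar α t * q ^ t : ℝ) : ℂ) ^ (N - M) *
        weightV q (alphaR h t α) (N - M) v := by
  have hx : Xlt (glueBlocks h t u v) t = M := by rw [Xlt_eq_sum ht, xL_glueBlocks ht, hu]
  rw [weightV, prod_fin_split (h - t) (by omega : h = t + (h - t)), Apar_mul_pow ht]
  push_cast
  rw [← Finset.prod_pow, weightV, weightV, ← Finset.prod_mul_distrib]
  congr 1
  · refine Finset.prod_congr rfl fun i _ => ?_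
    have h1 := xL_apply ht (glueBlocks h t u v) i
    rw [xL_glueBlocks ht] at h1
    have h2 := Xlt_of_le ht (glueBlocks h t u v) (show (i : ℕ) + 1 ≤ t by omega)
    rw [xL_glueBlocks ht] at h2
    have hne : (alphaL h t α i : ℂ) * (q : ℂ) ≠ 0 := by
      rw [alphaL_apply ht]
      exact_mod_cast mul_ne_zero (hα _).ne' hq
    rw [h2, ← h1, ← alphaL_apply ht α i]
    have e : (N : ℤ) - Xlt u (i + 1) = ((M : ℤ) - Xlt u (i + 1)) + ((N - M : ℕ) : ℤ) := by
      push_cast [hM]; ring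
    rw [e]
    push_cast
    rw [zpow_add₀ hne, zpow_natCast]
    ring
  · refine Finset.prod_congr rfl fun i _ => ?_
    have h1 := xR_apply (glueBlocks h t u v) i
    rw [xR_glueBlocks] at h1
    have h2 := Xlt_add ht (glueBlocks h t u v) (i + 1)
    rw [xR_glueBlocks, hx] at h2
    rw [add_assoc t, h2, ← h1, ← alphaR_apply α i]
    have e : (N : ℤ) - ((M + Xlt v (i + 1) : ℕ) : ℤ) = ((N - M : ℕ) : ℤ) - Xlt v (i + 1) := by
      push_cast [hM]; ring
    rw [e]
    push_cast
    ring

lemma innerV_eq (q : ℝ) {h : ℕ} (α : Fin h → ℝ) (N : ℕ) (f g : (Fin h → ℕ) → ℂ) :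
    innerV q α N f g = (q : ℂ) ^ (N * (N + 1) / 2) *
      ∑ x ∈ Finset.Nat.antidiagonalTuple h N, weightV q α N x * f x * (starRingEnd ℂ) (g x) := rfl

/-- The scalar product of functions of product type splits along the blocks. -/
lemma innerV_split {q : ℝ} (hq : q ≠ 0) {h t : ℕ} (ht : t ≤ h) (α : Fin h → ℝ)
    (hα : ∀ s, 0 < α s) (N : ℕ) (c d : ℕ → ℂ) (f' : ℕ → (Fin t → ℕ) → ℂ)
    (f'' : ℕ → (Fin (h - t) → ℕ) → ℂ) (f g : (Fin h → ℕ) → ℂ)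
    (hf : ∀ x, f x = c (Xlt x t) * f' (Xlt x t) (xL h t x) * f'' (N - Xlt x t) (xR h t x))
    (hg : ∀ x, g x = d (Xlt x t) * f' (Xlt x t) (xL h t x) * f'' (N - Xlt x t) (xR h t x)) :
    innerV q α N f g = ∑ M ∈ Finset.range (N + 1),
      (q : ℂ) ^ (M * (N - M)) * ((Apar α t * q ^ t : ℝ) : ℂ) ^ (N - M) *
        (c M * (starRingEnd ℂ) (d M)) *
        (innerV q (alphaL h t α) M (f' M) (f' M) *
          innerV q (alphaR h t α) (N - M) (f'' (N - M)) (f'' (N - M))) := by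
  rw [innerV_eq, sum_antidiagonalTuple_split ht, Finset.mul_sum]
  refine Finset.sum_congr rfl fun M hM => ?_
  have hM' : M ≤ N := Nat.lt_succ_iff.1 (Finset.mem_range.1 hM)
  rw [innerV_eq, innerV_eq]
  have e : N * (N + 1) / 2 = M * (N - M) + M * (M + 1) / 2 + (N - M) * (N - M + 1) / 2 := by
    obtain ⟨L, rfl⟩ := Nat.exists_eq_add_of_le hM'
    rw [Nat.add_sub_cancel_left]
    obtain ⟨r, hr⟩ := Nat.even_mul_succ_self M
    obtain ⟨s, hs⟩ := Nat.even_mul_succ_self L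
    have e1 : (M + L) * (M + L + 1) = 2 * (M * L + r + s) := by
      linear_combination hr + hs
    rw [hr, hs, e1, ← two_mul, ← two_mul]
    simp
  have e2 : ∑ u ∈ Finset.Nat.antidiagonalTuple t M,
      ∑ v ∈ Finset.Nat.antidiagonalTuple (h - t) (N - M),
        weightV q α N (glueBlocks h t u v) * f (glueBlocks h t u v) *
          (starRingEnd ℂ) (g (glueBlocks h t u v)) =
      ((Apar α t * q ^ t : ℝ) : ℂ) ^ (N - M) * (c M * (starRingEnd ℂ) (d M)) *
        ((∑ u ∈ Finset.Nat.antidiagonalTuple t M,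
          weightV q (alphaL h t α) M u * f' M u * (starRingEnd ℂ) (f' M u)) *
        ∑ v ∈ Finset.Nat.antidiagonalTuple (h - t) (N - M),
          weightV q (alphaR h t α) (N - M) v * f'' (N - M) v *
            (starRingEnd ℂ) (f'' (N - M) v)) := by
    rw [Finset.sum_mul_sum, Finset.mul_sum]
    refine Finset.sum_congr rfl fun u hu => ?_
    rw [Finset.mul_sum]
    refine Finset.sum_congr rfl fun v _ => ?_
    rw [Finset.Nat.mem_antidiagonalTuple] at hu
    rw [weightV_glueBlocks hq ht α hα hM' u hu v, hf, hg, Xlt_eq_sum ht, xL_glueBlocks ht,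
      xR_glueBlocks, hu, map_mul, map_mul]
    ring
  rw [e2, e, pow_add, pow_add]
  ring

/-- The exponent of `q` in the squared norms, with the degree written as `i + x`. -/
lemma normExponent_eq (z i x : ℤ) (hz : z = i + x) :
    ((z - 2 * i) ^ 2 + z + 2 * i - 2 * i ^ 2) / 2 =
      x * (x + 1) / 2 - x * i - i * (i + 1) / 2 + 2 * i := by
  subst hz
  obtain ⟨r, hr⟩ := Int.even_mul_succ_self x
  obtain ⟨s, hs⟩ := Int.even_mul_succ_self i
  rw [hr, hs, ← two_mul, ← two_mul, Int.mul_ediv_cancel_left _ two_ne_zero,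
    Int.mul_ediv_cancel_left _ two_ne_zero]
  apply Int.ediv_eq_of_eq_mul_right two_ne_zero
  linear_combination hr - hs

lemma triangle_add (x y : ℤ) :
    (x + y) * (x + y + 1) / 2 = x * (x + 1) / 2 + y * (y + 1) / 2 + x * y := by
  obtain ⟨r, hr⟩ := Int.even_mul_succ_self x
  obtain ⟨s, hs⟩ := Int.even_mul_succ_self y
  rw [hr, hs, ← two_mul, ← two_mul, Int.mul_ediv_cancel_left _ two_ne_zero,
    Int.mul_ediv_cancel_left _ two_ne_zero]
  apply Int.ediv_eq_of_eq_mul_right two_ne_zero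
  linear_combination hr + hs

lemma Apar_mul_pow_pos {h t : ℕ} (ht : t ≤ h) {q : ℝ} (hq0 : 0 < q) (α : Fin h → ℝ)
    (hα : ∀ s, 0 < α s) : 0 < Apar α t * q ^ t := by
  rw [Apar_mul_pow ht]
  exact Finset.prod_pos fun i _ => by rw [alphaL_apply ht]; exact mul_pos (hα _) hq0

lemma Apar_mul_pow_lt_one {h t : ℕ} (ht : t ≤ h) (ht1 : 1 ≤ t) {q : ℝ} (hq0 : 0 < q)
    (α : Fin h → ℝ) (hα : ∀ s, 0 < α s) (hα' : ∀ s, α s < q⁻¹) : Apar α t * q ^ t < 1 := by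
  rw [Apar_mul_pow ht]
  have hlt : ∀ i : Fin t, alphaL h t α i * q < 1 := fun i => by
    rw [alphaL_apply ht]
    exact (mul_lt_mul_of_pos_right (hα' _) hq0).trans_eq (inv_mul_cancel₀ hq0.ne')
  have hpos : ∀ i : Fin t, 0 < alphaL h t α i * q := fun i => by
    rw [alphaL_apply ht]; exact mul_pos (hα _) hq0
  calc _ < ∏ i : Fin t, (1 : ℝ) :=
        Finset.prod_lt_prod_of_nonempty (fun i _ => hpos i) (fun i _ => hlt i)
          ⟨⟨0, ht1⟩, Finset.mem_univ _⟩
    _ = 1 := by simp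

theorem stmt17 (q : ℝ) (hq0 : 0 < q) (hq1 : q < 1) (h t : ℕ) (hh : 2 ≤ h)
    (ht1 : 1 ≤ t) (ht2 : t ≤ h - 1)
    (α : Fin h → ℝ) (hα : ∀ s, 0 < α s) (hα' : ∀ s, α s < q⁻¹)
    (N i j : ℕ) (hij : i + j ≤ N) (Γ' Γ'' : ℝ)
    (f' : ℕ → (Fin t → ℕ) → ℂ) (f'' : ℕ → (Fin (h - t) → ℕ) → ℂ)
    (hnorm' : ∀ M : ℕ, i ≤ M → M ≤ N - j →
      innerV q (alphaL h t α) M (f' M) (f' M) =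
        (Γ' : ℂ) *
          ((qPoch q (Apar α t * q ^ (t + 2 * i)) (M - i) / qPoch q q (M - i) : ℝ) : ℂ) *
          (q : ℂ) ^ ((((M : ℤ) - 2 * i) ^ 2 + M + 2 * i - 2 * (i : ℤ) ^ 2) / 2))
    (hnorm'' : ∀ M : ℕ, i ≤ M → M ≤ N - j →
      innerV q (alphaR h t α) (N - M) (f'' (N - M)) (f'' (N - M)) =
        (Γ'' : ℂ) *
          ((qPoch q (Apar α h / Apar α t * q ^ (h - t + 2 * j)) (N - M - j) /
              qPoch q q (N - M - j) : ℝ) : ℂ) *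
          (q : ℂ) ^ ((((N : ℤ) - M - 2 * j) ^ 2 + ((N : ℤ) - M) + 2 * j - 2 * (j : ℤ) ^ 2) / 2))
    (n m : ℕ) (hn1 : i + j ≤ n) (hn2 : n ≤ N) (hm1 : i + j ≤ m) (hm2 : m ≤ N)
    (f g : (Fin h → ℕ) → ℂ)
    (hf : ∀ x : Fin h → ℕ,
      f x = if i ≤ Xlt x t ∧ Xlt x t ≤ N - j then
        (q : ℂ) ^ (-((j * Xlt x t : ℕ) : ℤ)) *
          qHahnQ q (Apar α t * q ^ (t + 2 * i - 1))
            (Apar α h / Apar α t * q ^ (h - t + 2 * j - 1)) (n - i - j) (N - i - j)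
            (Xlt x t - i) *
          f' (Xlt x t) (xL h t x) * f'' (N - Xlt x t) (xR h t x)
      else 0)
    (hg : ∀ x : Fin h → ℕ,
      g x = if i ≤ Xlt x t ∧ Xlt x t ≤ N - j then
        (q : ℂ) ^ (-((j * Xlt x t : ℕ) : ℤ)) *
          qHahnQ q (Apar α t * q ^ (t + 2 * i - 1))
            (Apar α h / Apar α t * q ^ (h - t + 2 * j - 1)) (m - i - j) (N - i - j)
            (Xlt x t - i) *
          f' (Xlt x t) (xL h t x) * f'' (N - Xlt x t) (xR h t x)
      else 0) :
    innerV q α N f g =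
      (if n = m then 1 else 0) *
        ((Γ' : ℂ) * (Γ'' : ℂ) *
          ((qPoch q q (n - i - j) * qPoch q (Apar α h * q ^ (h + n + i + j - 1)) (n - i - j) *
              qPoch q (Apar α h / Apar α t * q ^ (h - t + 2 * j)) (n - i - j) /
              qPoch q (Apar α t * q ^ (t + 2 * i)) (n - i - j) : ℝ) : ℂ) *
          ((Apar α t * q ^ (t + 2 * i) : ℝ) : ℂ) ^ (n - i) *
          (q : ℂ) ^ (-((2 * i * j + (n - i - j) : ℕ) : ℤ))) *
        ((qPoch q (Apar α h * q ^ (h + 2 * n)) (N - n) / qPoch q q (N - n) : ℝ) : ℂ) *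
        (q : ℂ) ^ ((((N : ℤ) - 2 * n) ^ 2 + N + 2 * n - 2 * (n : ℤ) ^ 2) / 2) := by
  have ht : t ≤ h := by omega
  have hq := hq0.ne'
  have hqc : (q : ℂ) ≠ 0 := by exact_mod_cast hq
  have hA0 := Apar_mul_pow_pos ht hq0 α hα
  have hA1 := Apar_mul_pow_lt_one ht ht1 hq0 α hα hα'
  have hAt : Apar α t ≠ 0 := left_ne_zero_of_mul hA0.ne'
  have hAh : Apar α h ≠ 0 := left_ne_zero_of_mul (Apar_mul_pow_pos le_rfl hq0 α hα).ne'
  obtain ⟨K, rfl⟩ : ∃ K, N = i + j + K := Nat.exists_eq_add_of_le hij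
  obtain ⟨n, rfl⟩ := Nat.exists_eq_add_of_le hn1
  obtain ⟨m, rfl⟩ := Nat.exists_eq_add_of_le hm1
  have en : i + j + n - i - j = n := by omega
  have em : i + j + m - i - j = m := by omega
  have eK : i + j + K - i - j = K := by omega
  have eN : i + j + K - j = i + K := by omega
  simp only [en, em, eK, eN] at *
  set a := Apar α t * q ^ (t + 2 * i - 1) with ha
  set b := Apar α h / Apar α t * q ^ (h - t + 2 * j - 1) with hb
  have haq : Apar α t * q ^ (t + 2 * i) = a * q := by
    rw [ha, mul_assoc, ← pow_succ]; congr 2; omega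
  have hbq : Apar α h / Apar α t * q ^ (h - t + 2 * j) = b * q := by
    rw [hb, mul_assoc, ← pow_succ]; congr 2; omega
  have hab1 : Apar α h * q ^ (h + (i + j + n) + i + j - 1) = a * b * q ^ (n + 1) := by
    rw [ha, hb]
    have : h + (i + j + n) + i + j - 1 =
      (t + 2 * i - 1) + (h - t + 2 * j - 1) + (n + 1) := by omega
    rw [this, pow_add, pow_add]
    field_simp
  have hab2 : Apar α h * q ^ (h + 2 * (i + j + n)) = a * b * q ^ (2 * n + 2) := by
    rw [ha, hb]
    have : h + 2 * (i + j + n) =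
      (t + 2 * i - 1) + (h - t + 2 * j - 1) + (2 * n + 2) := by omega
    rw [this, pow_add, pow_add]
    field_simp
  have ha0 : a ≠ 0 := mul_ne_zero hAt (pow_ne_zero _ hq)
  have hb0 : b ≠ 0 := mul_ne_zero (div_ne_zero hAh hAt) (pow_ne_zero _ hq)
  have haA : a * q = Apar α t * q ^ t * q ^ (2 * i) := by rw [← haq, pow_add]; ring
  have ha1 : a * q < 1 := by
    rw [haA]
    exact mul_lt_one_of_nonneg_of_lt_one_left hA0.le hA1 (pow_le_one₀ hq0.le hq1.le)
  rw [haq] at hnorm'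
  rw [hbq] at hnorm''
  rw [haq, hbq, hab1, hab2]
  have hsplit := innerV_split hq ht α hα (i + j + K)
    (fun M => if i ≤ M ∧ M ≤ i + K then
      (q : ℂ) ^ (-((j * M : ℕ) : ℤ)) * qHahnQ q a b n K (M - i) else 0)
    (fun M => if i ≤ M ∧ M ≤ i + K then
      (q : ℂ) ^ (-((j * M : ℕ) : ℤ)) * qHahnQ q a b m K (M - i) else 0) f' f'' f g
    (fun x => by rw [hf]; split_ifs <;> simp)
    (fun x => by rw [hg]; split_ifs <;> simp)
  have hsub : Finset.Ico i (i + (K + 1)) ⊆ Finset.range (i + j + K + 1) := fun M hM => by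
    rw [Finset.mem_Ico] at hM
    rw [Finset.mem_range]
    omega
  rw [hsplit, ← Finset.sum_subset hsub, Finset.sum_Ico_eq_sum_range, Nat.add_sub_cancel_left]
  swap
  · intro M _ hM
    rw [Finset.mem_Ico] at hM
    rw [if_neg (by omega)]
    simp
  set T : ℤ → ℤ := fun z => z * (z + 1) / 2 with hT
  set e : ℤ := T K - (i + j) * K - i * j - T i - T j + 2 * i + 2 * j with he
  have hterm : ∀ x ∈ Finset.range (K + 1),
      (q : ℂ) ^ ((i + x) * (i + j + K - (i + x))) *
        ((Apar α t * q ^ t : ℝ) : ℂ) ^ (i + j + K - (i + x)) *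
        ((if i ≤ i + x ∧ i + x ≤ i + K then
          (q : ℂ) ^ (-((j * (i + x) : ℕ) : ℤ)) * qHahnQ q a b n K (i + x - i) else 0) *
        (starRingEnd ℂ) (if i ≤ i + x ∧ i + x ≤ i + K then
          (q : ℂ) ^ (-((j * (i + x) : ℕ) : ℤ)) * qHahnQ q a b m K (i + x - i) else 0)) *
        (innerV q (alphaL h t α) (i + x) (f' (i + x)) (f' (i + x)) *
          innerV q (alphaR h t α) (i + j + K - (i + x)) (f'' (i + j + K - (i + x)))
            (f'' (i + j + K - (i + x)))) =
      (Γ' : ℂ) * Γ'' * ((Apar α t * q ^ t : ℝ) : ℂ) ^ j * (q : ℂ) ^ e *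
        ((qHahnWeight q a b K x * (qHahnR q a b n K x * qHahnR q a b m K x) : ℝ) : ℂ) := by
    intro x hx
    obtain ⟨y, rfl⟩ : ∃ y, K = x + y :=
      ⟨K - x, by have := Finset.mem_range.1 hx; omega⟩
    have hc : i ≤ i + x ∧ i + x ≤ i + (x + y) := by omega
    have e1 : i + j + (x + y) - (i + x) = j + y := by omega
    rw [hnorm' _ hc.1 hc.2, hnorm'' _ hc.1 hc.2, if_pos hc, if_pos hc, e1,
      Nat.add_sub_cancel_left, Nat.add_sub_cancel_left, qHahnQ_eq hq, qHahnQ_eq hq,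
      normExponent_eq _ i x (by push_cast; ring), normExponent_eq _ j y (by push_cast; ring)]
    have hconj : (starRingEnd ℂ) ((q : ℂ) ^ (-((j * (i + x) : ℕ) : ℤ))) =
        (q : ℂ) ^ (-((j * (i + x) : ℕ) : ℤ)) := by
      rw [map_zpow₀, Complex.conj_ofReal]
    rw [map_mul, hconj, Complex.conj_ofReal, qHahnWeight, haA, Nat.add_sub_cancel_left]
    have hexp : ((i + x) * (j + y) : ℤ) + -(j * (i + x)) + -(j * (i + x)) +
        (T x - x * i - T i + 2 * i) + (T y - y * j - T j + 2 * j) = e + 2 * i * y := by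
      have := triangle_add x y
      rw [he, hT]
      push_cast
      rw [this]
      ring
    have hpow : (q : ℂ) ^ ((i + x) * (j + y)) * (q : ℂ) ^ (-((j * (i + x) : ℕ) : ℤ)) *
        (q : ℂ) ^ (-((j * (i + x) : ℕ) : ℤ)) * (q : ℂ) ^ (T x - x * i - T i + 2 * i) *
        (q : ℂ) ^ (T y - y * j - T j + 2 * j) = (q : ℂ) ^ e * (q : ℂ) ^ (2 * i * y) := by
      rw [← zpow_natCast, ← zpow_natCast, ← zpow_add₀ hqc, ← zpow_add₀ hqc, ← zpow_add₀ hqc,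
        ← zpow_add₀ hqc, ← zpow_add₀ hqc]
      push_cast
      rw [hexp]
    rw [mul_pow _ (q ^ (2 * i)), ← pow_mul, pow_add _ j y]
    push_cast at hpow ⊢
    linear_combination (Γ' * Γ'' * ((Apar α t : ℂ) * q ^ t) ^ j * ((Apar α t : ℂ) * q ^ t) ^ y *
      (qPoch q (Apar α t * q ^ t * q ^ (2 * i)) x) / (qPoch q q x) *
      (qPoch q (b * q) y) / (qPoch q q y) * qHahnR q a b n (x + y) x *
      qHahnR q a b m (x + y) x) * hpow
  rw [Finset.sum_congr rfl hterm, ← Finset.mul_sum, ← Complex.ofReal_sum]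
  have hform : ∑ x ∈ Finset.range (K + 1),
      qHahnWeight q a b K x * (qHahnR q a b n K x * qHahnR q a b m K x) =
      qHahnForm q a b K (qHahnR q a b n K) (qHahnR q a b m K) := rfl
  rw [hform]
  by_cases hnm : n = m
  swap
  · rw [qHahnForm_qHahnR_of_ne hq0 hq1 ha1 hb0 (by omega) (by omega) hnm,
      if_neg (by omega)]
    simp
  subst hnm
  obtain ⟨k, rfl⟩ : ∃ k, K = n + k := Nat.exists_eq_add_of_le (by omega)
  have e2 : i + j + (n + k) - (i + j + n) = k := by omega
  have e3 : i + j + n - i = n + j := by omega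
  rw [qHahnForm_qHahnR_self hq0 hq1 ha0 ha1 hb0, if_pos rfl, e2, e3,
    normExponent_eq _ ((i + j + n : ℕ) : ℤ) k (by push_cast; ring)]
  have hexp : e + -((n ^ 2 + 2 * n * k : ℕ) : ℤ) =
      ((2 * i * j : ℕ) : ℤ) + (-((2 * i * j + n : ℕ) : ℤ) +
      ((k : ℤ) * (k + 1) / 2 - k * ((i + j + n : ℕ) : ℤ) -
        ((i + j + n : ℕ) : ℤ) * (((i + j + n : ℕ) : ℤ) + 1) / 2 + 2 * ((i + j + n : ℕ) : ℤ))) := by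
    have h1 := triangle_add n k
    have h2 := triangle_add (i + j) n
    have h3 := triangle_add i j
    obtain ⟨r, hr⟩ := Int.even_mul_succ_self n
    have h4 : (n : ℤ) * (n + 1) / 2 = r := by omega
    rw [he, hT]
    push_cast
    rw [h1, h2, h3, h4]
    linear_combination -hr
  have hpow : (q : ℂ) ^ e * ((q : ℂ) ^ (n ^ 2 + 2 * n * k))⁻¹ =
      (q : ℂ) ^ (2 * i * j) * ((q : ℂ) ^ (-((2 * i * j + n : ℕ) : ℤ)) *
      (q : ℂ) ^ ((k : ℤ) * (k + 1) / 2 - k * ((i + j + n : ℕ) : ℤ) -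
        ((i + j + n : ℕ) : ℤ) * (((i + j + n : ℕ) : ℤ) + 1) / 2 +
        2 * ((i + j + n : ℕ) : ℤ))) := by
    rw [← zpow_natCast, ← zpow_neg, ← zpow_natCast (q : ℂ) (2 * i * j), ← zpow_add₀ hqc,
      ← zpow_add₀ hqc, ← zpow_add₀ hqc, hexp]
  have haj : (a * q) ^ (n + j) = (a * q) ^ n * ((Apar α t * q ^ t) ^ j * q ^ (2 * i * j)) := by
    rw [pow_add]
    congr 1
    rw [haA, mul_pow, ← pow_mul]
  rw [← Complex.ofReal_pow (a * q), haj]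
  push_cast at hpow ⊢
  linear_combination (Γ' * Γ'' * ((Apar α t : ℂ) * q ^ t) ^ j *
    (qPoch q (a * b * q ^ (2 * n + 2)) k / qPoch q q k) *
    (qPoch q q n * qPoch q (b * q) n * ((a : ℂ) * q) ^ n * qPoch q (a * b * q ^ (n + 1)) n /
      qPoch q (a * q) n)) * hpow
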